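/- arXiv:2412.20178 — 2 statements merged into one kernel-verified Lean document; each statement's English description precedes it below -/
import Mathlib

section
/- Let n ≥ 1, Γ a set of formulas and α a formula, and suppose there exist n distinct propositional variables occurring in no formula of Γ ∪ {α}. If Γ ⊬_n α, then Γ ⊭_n α, i.e., there is an intuitionistic valuation V on the n-Medvedev frame F_n such that at the root r, (F_n,V), r ⊨ γ for all γ ∈ Γ but (F_n,V), r ⊭ α. -/
/-- Formulas of intuitionistic propositional logic, built from propositional
variables `p_0, p_1, …` (indexed by `ℕ`) and `⊥` using `∧`, `∨`, `→`. -/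
inductive Form : Type
  | var : ℕ → Form
  | bot : Form
  | and : Form → Form → Form
  | or : Form → Form → Form
  | imp : Form → Form → Form
  deriving DecidableEq

namespace Form

/-- `¬α` abbreviates `α → ⊥`. -/
def neg (φ : Form) : Form := φ.imp .bot

/-- `⊤` abbreviates `⊥ → ⊥`. -/
def top : Form := Form.bot.imp .bot

/-- The set of propositional variables occurring in a formula. -/
def vars : Form → Set ℕ
  | var p => {p}
  | bot => ∅
  | and φ ψ => φ.vars ∪ ψ.vars
  | or φ ψ => φ.vars ∪ ψ.vars
  | imp φ ψ => φ.vars ∪ ψ.vars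

/-- Uniform substitution, extended homomorphically to all formulas. -/
def subst (σ : ℕ → Form) : Form → Form
  | var p => σ p
  | bot => bot
  | and φ ψ => (φ.subst σ).and (ψ.subst σ)
  | or φ ψ => (φ.subst σ).or (ψ.subst σ)
  | imp φ ψ => (φ.subst σ).imp (ψ.subst σ)

end Form

/-- A valuation `V` on a poset is intuitionistic when every `V p` is upward closed. -/
def IsVal {P : Type} [PartialOrder P] (V : ℕ → Set P) : Prop :=
  ∀ p, ∀ x y : P, x ≤ y → x ∈ V p → y ∈ V p

/-- The standard Kripke forcing relation for intuitionistic propositional logic. -/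
def forces {P : Type} [PartialOrder P] (V : ℕ → Set P) : P → Form → Prop
  | w, .var p => w ∈ V p
  | _, .bot => False
  | w, .and φ ψ => forces V w φ ∧ forces V w ψ
  | w, .or φ ψ => forces V w φ ∨ forces V w ψ
  | w, .imp φ ψ => ∀ v, w ≤ v → forces V v φ → forces V v ψ

/-- A point `w` of a poset validates `φ` if `φ` is forced at `w` under every
intuitionistic valuation. -/
def valid {P : Type} [PartialOrder P] (w : P) (φ : Form) : Prop :=
  ∀ V : ℕ → Set P, IsVal V → forces V w φ

/-- Semantic consequence at a point: `Γ ⊨_{P,w} φ`. -/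
def Conseq {P : Type} [PartialOrder P] (Γ : Set Form) (w : P) (φ : Form) : Prop :=
  ∀ V : ℕ → Set P, IsVal V → (∀ γ ∈ Γ, forces V w γ) → forces V w φ

/-- The n-Medvedev frame: nonempty subsets of `{0,…,n−1}`. -/
def Med (n : ℕ) : Type := {X : Finset (Fin n) // X.Nonempty}

/-- The order on the n-Medvedev frame is reverse inclusion `⊇`. -/
instance (n : ℕ) : PartialOrder (Med n) where
  le X Y := Y.1 ⊆ X.1
  le_refl X := Finset.Subset.refl _
  le_trans X Y Z h1 h2 := Finset.Subset.trans h2 h1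
  le_antisymm X Y h1 h2 := Subtype.ext (Finset.Subset.antisymm h2 h1)

instance (n : ℕ) : Fintype (Med n) :=
  inferInstanceAs (Fintype {X : Finset (Fin n) // X.Nonempty})

/-- The root (least element) of the n-Medvedev frame: the full set `{0,…,n−1}`. -/
def root (n : ℕ) (hn : 1 ≤ n) : Med n := ⟨Finset.univ, ⟨⟨0, hn⟩, Finset.mem_univ _⟩⟩

/-- `endSet w` is the set of end points (maximal elements) above `w`. -/
def endSet {P : Type} [PartialOrder P] (w : P) : Set P := {e | IsMax e ∧ w ≤ e}

/-- Finite disjunction `⋁_{i} F i` (the empty disjunction is `⊥`). -/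
def bigDisj (n : ℕ) (F : Fin n → Form) : Form :=
  (List.finRange n).foldr (fun i acc => (F i).or acc) .bot

/-- `λ_i = p_i ∧ ⋀_{j ≠ i} ¬ p_j`, for a choice `p : Fin n → ℕ` of variables. -/
def lam (n : ℕ) (p : Fin n → ℕ) (i : Fin n) : Form :=
  (Form.var (p i)).and
    (((List.finRange n).filter (fun j => j ≠ i)).foldr
      (fun j acc => ((Form.var (p j)).neg).and acc) Form.top)

/-- A Hilbert-style axiomatization of intuitionistic propositional logic. -/
inductive IPC : Form → Prop
  | ax1 (φ ψ : Form) : IPC (φ.imp (ψ.imp φ))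
  | ax2 (φ ψ χ : Form) : IPC ((φ.imp (ψ.imp χ)).imp ((φ.imp ψ).imp (φ.imp χ)))
  | andI (φ ψ : Form) : IPC (φ.imp (ψ.imp (φ.and ψ)))
  | andE1 (φ ψ : Form) : IPC ((φ.and ψ).imp φ)
  | andE2 (φ ψ : Form) : IPC ((φ.and ψ).imp ψ)
  | orI1 (φ ψ : Form) : IPC (φ.imp (φ.or ψ))
  | orI2 (φ ψ : Form) : IPC (ψ.imp (φ.or ψ))
  | orE (φ ψ χ : Form) : IPC ((φ.imp χ).imp ((ψ.imp χ).imp ((φ.or ψ).imp χ)))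
  | botE (φ : Form) : IPC (Form.bot.imp φ)
  | mp {φ ψ : Form} : IPC (φ.imp ψ) → IPC φ → IPC ψ

/-- The Kreisel–Putnam formula `(¬p → q ∨ r) → ((¬p → q) ∨ (¬p → r))`. -/
def kpForm : Form :=
  ((Form.var 0).neg.imp ((Form.var 1).or (Form.var 2))).imp
    (((Form.var 0).neg.imp (Form.var 1)).or ((Form.var 0).neg.imp (Form.var 2)))

/-- The bounded-depth formulas: `bd_1 = p_1 ∨ (p_1 → ⊥)`,
`bd_{k+1} = p_{k+1} ∨ (p_{k+1} → bd_k)`. -/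
def bd : ℕ → Form
  | 0 => .bot
  | k + 1 => (Form.var (k + 1)).or ((Form.var (k + 1)).imp (bd k))

/-- `ML_n`: the smallest set of formulas containing all theorems of intuitionistic
propositional logic and all substitution instances of `kp` and `bd_n`, closed under
modus ponens, uniform substitution, and the Gabbay-style rule `Ed_n`. -/
inductive MLn (n : ℕ) : Form → Prop
  | ipc {φ : Form} : IPC φ → MLn n φ
  | kp : MLn n kpForm
  | bdn : MLn n (bd n)
  | mp {φ ψ : Form} : MLn n (φ.imp ψ) → MLn n φ → MLn n ψ
  | subst {φ : Form} (σ : ℕ → Form) : MLn n φ → MLn n (φ.subst σ)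
  | ed {α β : Form} (p : Fin n → ℕ) : Function.Injective p →
      (∀ i, p i ∉ α.vars ∧ p i ∉ β.vars) →
      MLn n (α.imp (β.or (bigDisj n fun i => (lam n p i).neg))) →
      MLn n (α.imp β)

/-- `Γ ⊢_n φ`: there are finitely many `γ_1, …, γ_k ∈ Γ` with
`(γ_1 ∧ … ∧ γ_k) → φ ∈ ML_n`. -/
def Proves (n : ℕ) (Γ : Set Form) (φ : Form) : Prop :=
  ∃ l : List Form, (∀ γ ∈ l, γ ∈ Γ) ∧ MLn n ((l.foldr Form.and Form.top).imp φ)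

/-- Disjunction `⋁_{i ∈ I} F i` over a finite set of indices. -/
def disjOver {n : ℕ} (I : Finset (Fin n)) (F : Fin n → Form) : Form :=
  ((List.finRange n).filter (fun i => i ∈ I)).foldr (fun i acc => (F i).or acc) .bot

/-- `α_I = ¬¬ ⋁_{i ∈ I} α_i`. -/
def alphaI {n : ℕ} (I : Finset (Fin n)) (α : Fin n → Form) : Form :=
  ((disjOver I α).neg).neg

open Classical in
/-- `α_S = ⋁_{I ∈ S} α_I` for a set `S` of points of the n-Medvedev frame
(with `α_∅ = ⊥`). -/
noncomputable def alphaS {n : ℕ} (S : Set (Med n)) (α : Fin n → Form) : Form :=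
  ((Finset.univ : Finset (Med n)).filter (fun I => I ∈ S)).toList.foldr
    (fun I acc => (alphaI I.1 α).or acc) .bot

/-! ### Theories -/

/-- A set of formulas containing `ML_n` and closed under modus ponens. -/
structure IsTheory (n : ℕ) (T : Set Form) : Prop where
  of_mln : ∀ {φ : Form}, MLn n φ → φ ∈ T
  mp : ∀ {φ ψ : Form}, φ.imp ψ ∈ T → φ ∈ T → ψ ∈ T

/-- A consistent theory with the disjunction property. -/
structure IsPrimeTheory (n : ℕ) (T : Set Form) : Prop extends IsTheory n T where
  bot_notMem : Form.bot ∉ T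
  prime : ∀ {φ ψ : Form}, φ.or ψ ∈ T → φ ∈ T ∨ ψ ∈ T

namespace IsTheory

variable {n : ℕ} {T : Set Form} {φ ψ χ : Form}

theorem of_ipc (hT : IsTheory n T) (h : IPC φ) : φ ∈ T := hT.of_mln (.ipc h)

theorem weaken (hT : IsTheory n T) (h : φ ∈ T) : ψ.imp φ ∈ T :=
  hT.mp (hT.of_ipc (.ax1 φ ψ)) h

theorem imp_self (hT : IsTheory n T) (φ : Form) : φ.imp φ ∈ T :=
  hT.mp (hT.mp (hT.of_ipc (.ax2 φ (φ.imp φ) φ)) (hT.of_ipc (.ax1 _ _))) (hT.of_ipc (.ax1 _ _))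

theorem and_mem (hT : IsTheory n T) (h₁ : φ ∈ T) (h₂ : ψ ∈ T) : φ.and ψ ∈ T :=
  hT.mp (hT.mp (hT.of_ipc (.andI φ ψ)) h₁) h₂

theorem left_mem (hT : IsTheory n T) (h : φ.and ψ ∈ T) : φ ∈ T :=
  hT.mp (hT.of_ipc (.andE1 φ ψ)) h

theorem right_mem (hT : IsTheory n T) (h : φ.and ψ ∈ T) : ψ ∈ T :=
  hT.mp (hT.of_ipc (.andE2 φ ψ)) h

theorem or_mem_left (hT : IsTheory n T) (h : φ ∈ T) : φ.or ψ ∈ T :=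
  hT.mp (hT.of_ipc (.orI1 φ ψ)) h

theorem or_mem_right (hT : IsTheory n T) (h : ψ ∈ T) : φ.or ψ ∈ T :=
  hT.mp (hT.of_ipc (.orI2 φ ψ)) h

theorem or_imp_mem (hT : IsTheory n T) (h₁ : φ.imp χ ∈ T) (h₂ : ψ.imp χ ∈ T) :
    (φ.or ψ).imp χ ∈ T :=
  hT.mp (hT.mp (hT.of_ipc (.orE φ ψ χ)) h₁) h₂

theorem of_bot (hT : IsTheory n T) (h : Form.bot ∈ T) : φ ∈ T :=
  hT.mp (hT.of_ipc (.botE φ)) h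

theorem top_mem (hT : IsTheory n T) : Form.top ∈ T := hT.imp_self _

/-- The deduction theorem: the consequences of `T` together with `φ` form a theory. -/
theorem adjoin (hT : IsTheory n T) (φ : Form) : IsTheory n {ψ | φ.imp ψ ∈ T} where
  of_mln h := hT.weaken (hT.of_mln h)
  mp {ψ χ} h₁ h₂ := hT.mp (hT.mp (hT.of_ipc (.ax2 φ ψ χ)) h₁) h₂

theorem imp_trans (hT : IsTheory n T) (h₁ : φ.imp ψ ∈ T) (h₂ : ψ.imp χ ∈ T) : φ.imp χ ∈ T :=
  (hT.adjoin φ).mp (hT.weaken h₂) h₁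

theorem or_imp_or_mem (hT : IsTheory n T) {φ' ψ' : Form} (h₁ : φ.imp φ' ∈ T)
    (h₂ : ψ.imp ψ' ∈ T) : (φ.or ψ).imp (φ'.or ψ') ∈ T :=
  hT.or_imp_mem (hT.imp_trans h₁ (hT.of_ipc (.orI1 _ _)))
    (hT.imp_trans h₂ (hT.of_ipc (.orI2 _ _)))

theorem foldr_and_mem_iff (hT : IsTheory n T) {ι : Type} (l : List ι) (F : ι → Form) :
    l.foldr (fun i acc => (F i).and acc) Form.top ∈ T ↔ ∀ i ∈ l, F i ∈ T := by
  induction l with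
  | nil => simpa using hT.top_mem
  | cons i l ih =>
    simp only [List.foldr_cons, List.forall_mem_cons, ← ih]
    exact ⟨fun h => ⟨hT.left_mem h, hT.right_mem h⟩, fun h => hT.and_mem h.1 h.2⟩

theorem foldr_or_mem (hT : IsTheory n T) {ι : Type} {l : List ι} {F : ι → Form} {i : ι}
    (hi : i ∈ l) (h : F i ∈ T) : l.foldr (fun i acc => (F i).or acc) Form.bot ∈ T := by
  induction l with
  | nil => simp at hi
  | cons j l ih =>
    rcases List.mem_cons.1 hi with rfl | hi
    · exact hT.or_mem_left h
    · exact hT.or_mem_right (ih hi)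

end IsTheory

theorem isTheory_mln (n : ℕ) : IsTheory n {φ | MLn n φ} := ⟨id, MLn.mp⟩

theorem isTheory_sUnion {n : ℕ} {c : Set (Set Form)} (hc : IsChain (· ⊆ ·) c)
    (hne : c.Nonempty) (h : ∀ T ∈ c, IsTheory n T) : IsTheory n (⋃₀ c) where
  of_mln hφ := let ⟨T, hT⟩ := hne; ⟨T, hT, (h T hT).of_mln hφ⟩
  mp := by
    rintro φ ψ ⟨T, hT, h₁⟩ ⟨S, hS, h₂⟩
    rcases hc.total hT hS with hTS | hST
    · exact ⟨S, hS, (h S hS).mp (hTS h₁) h₂⟩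
    · exact ⟨T, hT, (h T hT).mp h₁ (hST h₂)⟩

theorem IsTheory.exists_prime_disjoint {n : ℕ} {T Δ : Set Form} (hT : IsTheory n T)
    (hne : Δ.Nonempty) (hor : ∀ φ ∈ Δ, ∀ ψ ∈ Δ, φ.or ψ ∈ Δ) (hd : Disjoint T Δ) :
    ∃ S, IsPrimeTheory n S ∧ T ⊆ S ∧ Disjoint S Δ := by
  obtain ⟨S, hTS, hS⟩ := zorn_subset_nonempty {S | IsTheory n S ∧ Disjoint S Δ}
    (fun c hc hchain hcne => ⟨⋃₀ c,
      ⟨isTheory_sUnion hchain hcne fun T hT => (hc hT).1,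
        Set.disjoint_sUnion_left.2 fun T hT => (hc hT).2⟩,
      fun T hT => Set.subset_sUnion_of_mem hT⟩) T ⟨hT, hd⟩
  obtain ⟨⟨hth, hdis⟩, hmax⟩ := hS
  have key : ∀ φ, φ ∉ S → ∃ δ ∈ Δ, φ.imp δ ∈ S := by
    intro φ hφ
    by_contra! hcon
    exact hφ (hmax ⟨hth.adjoin φ, Set.disjoint_left.2 fun δ h₁ h₂ => hcon δ h₂ h₁⟩
      (fun ψ hψ => hth.weaken hψ) (hth.imp_self φ))
  refine ⟨S, ⟨hth, ?_, ?_⟩, hTS, hdis⟩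
  · intro hbot
    obtain ⟨δ, hδ⟩ := hne
    exact Set.disjoint_left.1 hdis (hth.of_bot hbot) hδ
  · intro φ ψ h
    by_contra! hcon
    obtain ⟨δ, hδ, h₁⟩ := key φ hcon.1
    obtain ⟨ε, hε, h₂⟩ := key ψ hcon.2
    exact Set.disjoint_left.1 hdis (hth.mp (hth.or_imp_or_mem h₁ h₂) h) (hor δ hδ ε hε)

theorem IsTheory.exists_prime_notMem {n : ℕ} {T : Set Form} {φ : Form} (hT : IsTheory n T)
    (hφ : φ ∉ T) : ∃ S, IsPrimeTheory n S ∧ T ⊆ S ∧ φ ∉ S := by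
  obtain ⟨S, hS, hTS, hd⟩ := hT.exists_prime_disjoint (Δ := {χ | MLn n (χ.imp φ)})
    ⟨φ, (isTheory_mln n).imp_self φ⟩ (fun _ h₁ _ h₂ => (isTheory_mln n).or_imp_mem h₁ h₂)
    (Set.disjoint_left.2 fun χ h₁ h₂ => hφ (hT.mp (hT.of_mln h₂) h₁))
  exact ⟨S, hS, hTS, fun h => Set.disjoint_left.1 hd h ((isTheory_mln n).imp_self φ)⟩

theorem isTheory_proves (n : ℕ) (Γ : Set Form) : IsTheory n {φ | Proves n Γ φ} where
  of_mln h := ⟨[], by simp, (isTheory_mln n).weaken h⟩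
  mp := by
    rintro φ ψ ⟨l, hl, h₁⟩ ⟨m, hm, h₂⟩
    refine ⟨l ++ m, fun γ hγ => (List.mem_append.1 hγ).elim (hl γ) (hm γ), ?_⟩
    have hadj := (isTheory_mln n).adjoin ((l ++ m).foldr Form.and Form.top)
    have hall := (hadj.foldr_and_mem_iff (l ++ m) id).1 ((isTheory_mln n).imp_self _)
    exact hadj.mp
      (hadj.mp (hadj.of_mln h₁) ((hadj.foldr_and_mem_iff l id).2
        fun γ hγ => hall γ (List.mem_append_left _ hγ)))
      (hadj.mp (hadj.of_mln h₂) ((hadj.foldr_and_mem_iff m id).2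
        fun γ hγ => hall γ (List.mem_append_right _ hγ)))

theorem proves_of_mem {n : ℕ} {Γ : Set Form} {γ : Form} (h : γ ∈ Γ) : Proves n Γ γ :=
  ⟨[γ], by simpa using h, .ipc (.andE1 _ _)⟩

theorem notMem_vars_foldr_and {p : ℕ} {l : List Form} (h : ∀ γ ∈ l, p ∉ γ.vars) :
    p ∉ (l.foldr Form.and Form.top).vars := by
  induction l with
  | nil => simp [Form.top, Form.vars]
  | cons γ l ih =>
    simp only [List.forall_mem_cons] at h
    simp [Form.vars, h.1, ih h.2]

/-! ### The canonical frame -/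

/-- The canonical frame of `ML_n`: prime theories ordered by inclusion. -/
abbrev Canon (n : ℕ) : Type := {T : Set Form // IsPrimeTheory n T}

theorem Canon.imp_mem_iff {n : ℕ} (T : Canon n) (φ ψ : Form) :
    φ.imp ψ ∈ T.1 ↔ ∀ S : Canon n, T ≤ S → φ ∈ S.1 → ψ ∈ S.1 := by
  refine ⟨fun h S hTS hφ => S.2.mp (hTS h) hφ, fun h => ?_⟩
  by_contra hcon
  have hT := T.2.toIsTheory
  obtain ⟨S, hS, hTS, hψ⟩ := (hT.adjoin φ).exists_prime_notMem hcon
  exact hψ (h ⟨S, hS⟩ (fun χ hχ => hTS (hT.weaken hχ)) (hTS (hT.imp_self φ)))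

theorem Canon.neg_mem_of_isMax {n : ℕ} {T : Canon n} (hT : IsMax T) {φ : Form}
    (h : φ ∉ T.1) : φ.neg ∈ T.1 :=
  (T.imp_mem_iff φ .bot).2 fun _ hTS hφ => absurd (hT hTS hφ) h

theorem Canon.neg_imp_mem_or {n : ℕ} (T : Canon n) {φ ψ χ : Form}
    (h : φ.neg.imp (ψ.or χ) ∈ T.1) : φ.neg.imp ψ ∈ T.1 ∨ φ.neg.imp χ ∈ T.1 :=
  T.2.prime (T.2.mp (T.2.of_mln (MLn.kp.subst
    fun k => if k = 0 then φ else if k = 1 then ψ else χ)) h)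

theorem Canon.exists_endSet_subset_union {n : ℕ} {w u v : Canon n} (hu : w ≤ u) (hv : w ≤ v) :
    ∃ t, w ≤ t ∧ t ≤ u ∧ t ≤ v ∧ endSet t ⊆ endSet u ∪ endSet v := by
  have hw := w.2.toIsTheory
  have hL := isTheory_mln n
  have hN : IsTheory n {φ | ∃ χ : Form, χ.neg ∈ u.1 ∧ χ.neg ∈ v.1 ∧ χ.neg.imp φ ∈ w.1} := by
    refine ⟨fun h => ⟨.bot, u.2.imp_self _, v.2.imp_self _, hw.weaken (hw.of_mln h)⟩, ?_⟩
    rintro φ ψ ⟨a, hau, hav, h₁⟩ ⟨b, hbu, hbv, h₂⟩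
    refine ⟨a.or b, u.2.or_imp_mem hau hbu, v.2.or_imp_mem hav hbv, ?_⟩
    have hadj := hw.adjoin (a.or b).neg
    have hab : (a.or b).neg ∈ {ψ | (a.or b).neg.imp ψ ∈ w.1} := hw.imp_self _
    exact hadj.mp
      (hadj.mp (hw.weaken h₁) (hadj.imp_trans (hadj.of_ipc (.orI1 _ _)) hab))
      (hadj.mp (hw.weaken h₂) (hadj.imp_trans (hadj.of_ipc (.orI2 _ _)) hab))
  obtain ⟨t, ht, hsub, hd⟩ := hN.exists_prime_disjoint
    (Δ := {φ | ∃ a b : Form, a ∉ u.1 ∧ b ∉ v.1 ∧ MLn n (φ.imp (a.or b))})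
    ⟨.bot, .bot, .bot, u.2.bot_notMem, v.2.bot_notMem, .ipc (.botE _)⟩
    (by
      rintro φ ⟨a, b, ha, hb, h₁⟩ ψ ⟨c, d, hc, hd, h₂⟩
      refine ⟨a.or c, b.or d, fun h => (u.2.prime h).elim ha hc,
        fun h => (v.2.prime h).elim hb hd, hL.or_imp_mem ?_ ?_⟩
      · exact hL.imp_trans h₁ (hL.or_imp_or_mem (.ipc (.orI1 _ _)) (.ipc (.orI1 _ _)))
      · exact hL.imp_trans h₂ (hL.or_imp_or_mem (.ipc (.orI2 _ _)) (.ipc (.orI2 _ _))))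
    (by
      refine Set.disjoint_left.2 ?_
      rintro φ ⟨χ, hχu, hχv, h⟩ ⟨a, b, ha, hb, hφ⟩
      rcases w.neg_imp_mem_or (hw.imp_trans h (hw.of_mln hφ)) with h | h
      · exact ha (u.2.mp (hu h) hχu)
      · exact hb (v.2.mp (hv h) hχv))
  refine ⟨⟨t, ht⟩, fun φ hφ => hsub ⟨.bot, u.2.imp_self _, v.2.imp_self _, hw.weaken hφ⟩,
    fun φ hφ => ?_, fun φ hφ => ?_, fun e ⟨he, hte⟩ => ?_⟩
  · by_contra hcon
    exact Set.disjoint_left.1 hd hφ ⟨φ, .bot, hcon, v.2.bot_notMem, .ipc (.orI1 _ _)⟩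
  · by_contra hcon
    exact Set.disjoint_left.1 hd hφ ⟨.bot, φ, u.2.bot_notMem, hcon, .ipc (.orI2 _ _)⟩
  · by_contra hcon
    have hue : ¬ u.1 ⊆ e.1 := fun h => hcon (.inl ⟨he, h⟩)
    have hve : ¬ v.1 ⊆ e.1 := fun h => hcon (.inr ⟨he, h⟩)
    obtain ⟨a, hau, hae⟩ := Set.not_subset.1 hue
    obtain ⟨b, hbv, hbe⟩ := Set.not_subset.1 hve
    have hneg : (a.or b).neg ∈ e.1 :=
      e.2.or_imp_mem (neg_mem_of_isMax he hae) (neg_mem_of_isMax he hbe)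
    have hdn : ∀ s : Canon n, a.or b ∈ s.1 → (a.or b).neg.neg ∈ s.1 := fun s hs =>
      (s.imp_mem_iff _ _).2 fun r hsr hr => r.2.mp hr (hsr hs)
    have : (a.or b).neg.neg ∈ e.1 := hte (hsub ⟨(a.or b).neg, hdn u (u.2.or_mem_left hau),
      hdn v (v.2.or_mem_right hbv), hw.imp_self _⟩)
    exact e.2.bot_notMem (e.2.mp this hneg)

/-! ### Frames of bounded depth -/

/-- There is a strictly increasing chain of `k + 1` points starting at `w`. -/
def HasChain {P : Type} [PartialOrder P] : ℕ → P → Prop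
  | 0, _ => True
  | k + 1, w => ∃ v, w < v ∧ HasChain k v

theorem subst_bd_congr {σ τ : ℕ → Form} {k : ℕ} (h : ∀ i ≤ k, σ i = τ i) :
    (bd k).subst σ = (bd k).subst τ := by
  induction k with
  | zero => rfl
  | succ k ih => simp [bd, Form.subst, h (k + 1) le_rfl, ih fun i hi => h i (by omega)]

theorem Canon.exists_subst_bd_notMem {n k : ℕ} {T : Canon n} (h : HasChain k T) :
    ∃ σ, (bd k).subst σ ∉ T.1 := by
  induction k generalizing T with
  | zero => exact ⟨.var, T.2.bot_notMem⟩
  | succ k ih =>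
    obtain ⟨S, hTS, hS⟩ := h
    obtain ⟨σ, hσ⟩ := ih hS
    obtain ⟨φ, hφS, hφT⟩ := Set.exists_of_ssubset (show T.1 ⊂ S.1 from hTS)
    refine ⟨Function.update σ (k + 1) φ, fun hmem => ?_⟩
    have hcongr : (bd k).subst (Function.update σ (k + 1) φ) = (bd k).subst σ :=
      subst_bd_congr fun i hi => Function.update_of_ne (by omega) _ _
    simp only [bd, Form.subst, Function.update_self, hcongr] at hmem
    rcases T.2.prime hmem with hmem | hmem
    · exact hφT hmem
    · exact hσ (S.2.mp (hTS.le hmem) hφS)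

theorem Canon.not_hasChain {n : ℕ} (T : Canon n) : ¬ HasChain n T := fun h =>
  let ⟨σ, hσ⟩ := exists_subst_bd_notMem h
  hσ (T.2.of_mln (MLn.bdn.subst σ))

section Frames

variable {P : Type} [PartialOrder P]

theorem HasChain.of_le {k : ℕ} {w v : P} (hwv : w ≤ v) (h : HasChain k v) : HasChain k w := by
  cases k with
  | zero => trivial
  | succ k => exact let ⟨u, hvu, hu⟩ := h; ⟨u, hwv.trans_lt hvu, hu⟩

theorem endSet_anti {w v : P} (h : w ≤ v) : endSet v ⊆ endSet w := fun _ he => ⟨he.1, h.trans he.2⟩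

theorem endSet_of_isMax {e : P} (he : IsMax e) : endSet e = {e} :=
  Set.ext fun _ => ⟨fun h => (he.eq_of_le h.2).symm, by rintro rfl; exact ⟨he, le_rfl⟩⟩

theorem endSet_nonempty_of_not_hasChain {k : ℕ} {w : P} (h : ¬ HasChain k w) :
    (endSet w).Nonempty := by
  induction k generalizing w with
  | zero => exact absurd trivial h
  | succ k ih =>
    by_cases hw : IsMax w
    · exact ⟨w, hw, le_rfl⟩
    · obtain ⟨v, hv⟩ := not_isMax_iff.1 hw
      obtain ⟨e, he⟩ := ih fun hc => h ⟨v, hv, hc⟩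
      exact ⟨e, endSet_anti hv.le he⟩

/-- The frame condition of the Kreisel–Putnam formula. -/
def KPFrame (P : Type) [PartialOrder P] : Prop :=
  ∀ ⦃w u v : P⦄, w ≤ u → w ≤ v →
    ∃ t, w ≤ t ∧ t ≤ u ∧ t ≤ v ∧ endSet t ⊆ endSet u ∪ endSet v

open Classical in
theorem KPFrame.exists_le_endSet_eq_union (hP : KPFrame P) {w t : P} {m : ℕ} (hwt : w ≤ t)
    (hm : HasChain m t) (D : Finset P) (hD : ↑D ⊆ endSet w) (hdisj : Disjoint (endSet t) ↑D) :
    ∃ s, w ≤ s ∧ s ≤ t ∧ endSet s = endSet t ∪ ↑D ∧ HasChain (m + D.card) s := by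
  induction D using Finset.induction_on with
  | empty => exact ⟨t, hwt, le_rfl, by simp, by simpa using hm⟩
  | insert e D heD ih =>
    rw [Finset.coe_insert, Set.insert_subset_iff] at hD
    rw [Finset.coe_insert, Set.disjoint_insert_right] at hdisj
    obtain ⟨s, hws, hst, hs, hc⟩ := ih hD.2 hdisj.2
    obtain ⟨r, hwr, hrs, hre, hr⟩ := hP hws hD.1.2
    have heq : endSet r = endSet s ∪ endSet e :=
      hr.antisymm (Set.union_subset (endSet_anti hrs) (endSet_anti hre))
    have hes : e ∉ endSet s := by
      rw [hs]; exact fun h => h.elim hdisj.1 (by simpa using heD)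
    have hlt : r < s := hrs.lt_of_ne fun h => hes (h ▸ ⟨hD.1.1, hre⟩)
    refine ⟨r, hwr, hrs.trans hst, ?_, ?_⟩
    · rw [heq, hs, endSet_of_isMax hD.1.1, Finset.coe_insert, Set.union_assoc, Set.union_singleton]
    · rw [Finset.card_insert_of_notMem heD, ← Nat.add_assoc]
      exact ⟨s, hlt, hc⟩

open Classical in
theorem KPFrame.exists_endSet_eq (hP : KPFrame P) {w : P} {Y : Finset P} (hY : Y.Nonempty)
    (hYw : ↑Y ⊆ endSet w) : ∃ s, w ≤ s ∧ endSet s = ↑Y ∧ HasChain (Y.card - 1) s := by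
  obtain ⟨e, he⟩ := hY
  have hew := hYw he
  have hee := endSet_of_isMax hew.1
  obtain ⟨s, hws, -, hs, hc⟩ := hP.exists_le_endSet_eq_union (m := 0) hew.2 trivial (Y.erase e)
    (fun x hx => hYw (Finset.mem_of_mem_erase hx)) (by simp [hee])
  refine ⟨s, hws, ?_, ?_⟩
  · rw [hs, hee, ← Finset.coe_singleton, ← Finset.coe_union, ← Finset.insert_eq,
      Finset.insert_erase he]
  · simpa [Finset.card_erase_of_mem he] using hc

theorem KPFrame.endSet_eq_of_card (hP : KPFrame P) {n : ℕ} (hdepth : ∀ x : P, ¬ HasChain n x)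
    {w : P} {E : Finset P} (hE : ↑E ⊆ endSet w) (hcard : E.card = n) : endSet w = ↑E := by
  classical
  refine (Set.Subset.antisymm hE fun e he => ?_).symm
  by_contra heE
  obtain ⟨s, -, -, hs⟩ := hP.exists_endSet_eq (Y := insert e E) (Finset.insert_nonempty _ _)
    (by rw [Finset.coe_insert]; exact Set.insert_subset he hE)
  rw [Finset.card_insert_of_notMem heE, hcard, Nat.add_sub_cancel] at hs
  exact hdepth s hs

theorem KPFrame.eq_of_le_of_endSet_eq (hP : KPFrame P) {n : ℕ}
    (hdepth : ∀ x : P, ¬ HasChain n x) {w : P} {E : Finset P} (hE : endSet w = ↑E)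
    (hcard : E.card = n) {t u : P} (hwt : w ≤ t) (htu : t ≤ u) (h : endSet t = endSet u) :
    t = u := by
  classical
  by_contra hne
  have hsub : endSet u ⊆ ↑E := hE ▸ endSet_anti (hwt.trans htu)
  obtain ⟨I, hI⟩ : ∃ I : Finset P, endSet u = ↑I :=
    ⟨((E.finite_toSet).subset hsub).toFinset, by simp⟩
  have hIE : I ⊆ E := by rw [hI] at hsub; exact_mod_cast hsub
  have hIne : I.Nonempty := by
    have := endSet_nonempty_of_not_hasChain (hdepth u)
    rw [hI] at this; exact_mod_cast this
  obtain ⟨s, hus, -, hs⟩ := hP.exists_endSet_eq hIne hI.ge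
  have hct : HasChain (I.card - 1 + 1) t := ⟨u, htu.lt_of_ne hne, hs.of_le hus⟩
  rw [Nat.sub_add_cancel hIne.card_pos] at hct
  obtain ⟨r, -, -, -, hr⟩ := hP.exists_le_endSet_eq_union hwt hct (E \ I)
    (by rw [hE]; exact_mod_cast Finset.sdiff_subset)
    (by rw [h, hI]; exact_mod_cast Finset.disjoint_sdiff)
  rw [Finset.card_sdiff_of_subset hIE, hcard] at hr
  have := hcard ▸ Finset.card_le_card hIE
  rw [Nat.add_sub_cancel' this] at hr
  exact hdepth r hr

theorem KPFrame.endSet_injOn (hP : KPFrame P) {n : ℕ} (hdepth : ∀ x : P, ¬ HasChain n x)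
    {w : P} {E : Finset P} (hE : endSet w = ↑E) (hcard : E.card = n) :
    Set.InjOn endSet (Set.Ici w) := by
  intro u hu v hv h
  obtain ⟨t, hwt, htu, htv, ht⟩ := hP hu hv
  have htu' : endSet t = endSet u :=
    Set.Subset.antisymm (by rwa [← h, Set.union_self] at ht) (endSet_anti htu)
  exact (hP.eq_of_le_of_endSet_eq hdepth hE hcard hwt htu htu').symm.trans
    (hP.eq_of_le_of_endSet_eq hdepth hE hcard hwt htv (htu'.trans h))

/-- A Kreisel–Putnam frame of depth at most `n` whose root `w` sees `n` end points is a bounded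
morphic image of the `n`-Medvedev frame. -/
theorem KPFrame.exists_boundedMorphism (hP : KPFrame P) {n : ℕ} (hn : 1 ≤ n)
    (hdepth : ∀ x : P, ¬ HasChain n x) {w : P} {e : Fin n → P} (he : Function.Injective e)
    (hew : ∀ i, e i ∈ endSet w) :
    ∃ g : Med n → P, g (root n hn) = w ∧ Monotone g ∧
      ∀ X t, g X ≤ t → ∃ Y, X ≤ Y ∧ g Y = t := by
  classical
  have himg : ∀ X : Finset (Fin n), ↑(X.map ⟨e, he⟩) ⊆ Set.range e := fun X => by
    simp
  have hE : endSet w = ↑((Finset.univ : Finset (Fin n)).map ⟨e, he⟩) :=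
    hP.endSet_eq_of_card hdepth
      ((himg _).trans (Set.range_subset_iff.2 hew)) (by simp)
  have hinj := hP.endSet_injOn hdepth hE (by simp)
  have hex : ∀ X : Med n, ∃ s, w ≤ s ∧ endSet s = e '' ↑X.1 := fun X => by
    obtain ⟨s, hws, hs, -⟩ := hP.exists_endSet_eq (w := w) (Y := X.1.map ⟨e, he⟩) (X.2.map)
      ((himg _).trans (Set.range_subset_iff.2 hew))
    exact ⟨s, hws, by simpa using hs⟩
  choose g hwg hg using hex
  refine ⟨g, hinj (hwg _) le_rfl ?_, fun X Y hXY => ?_, fun X t hXt => ?_⟩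
  · rw [hg, hE]; simp [root]
  · have hYX : e '' ↑Y.1 ⊆ endSet (g X) := by
      rw [hg]; exact Set.image_mono (by exact_mod_cast hXY)
    obtain ⟨s, hs, hsY, -⟩ := hP.exists_endSet_eq (w := g X) (Y := Y.1.map ⟨e, he⟩) (Y.2.map)
      (by simpa using hYX)
    have : s = g Y := hinj ((hwg X).trans hs) (hwg Y) (by rw [hg, hsY]; simp)
    exact this ▸ hs
  · have hwt := (hwg X).trans hXt
    have htX : endSet t ⊆ e '' ↑X.1 := hg X ▸ endSet_anti hXt
    obtain ⟨i, hi⟩ : (X.1.filter fun i => e i ∈ endSet t).Nonempty := by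
      obtain ⟨x, hx⟩ := endSet_nonempty_of_not_hasChain (hdepth t)
      obtain ⟨i, hi, rfl⟩ := htX hx
      exact ⟨i, Finset.mem_filter.2 ⟨hi, hx⟩⟩
    refine ⟨⟨X.1.filter fun i => e i ∈ endSet t, i, hi⟩, Finset.filter_subset _ _,
      hinj (hwg _) hwt ((hg _).trans ?_)⟩
    ext x
    constructor
    · rintro ⟨j, hj, rfl⟩
      exact (Finset.mem_filter.1 hj).2
    · intro hx
      obtain ⟨j, hj, rfl⟩ := htX hx
      exact ⟨j, Finset.mem_filter.2 ⟨hj, hx⟩, rfl⟩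

end Frames

/-- The truth lemma for models obtained from the canonical one along a bounded morphism. -/
theorem forces_iff_mem_of_boundedMorphism {P : Type} [PartialOrder P] {n : ℕ} {g : P → Canon n}
    (hmono : Monotone g) (hback : ∀ x t, g x ≤ t → ∃ y, x ≤ y ∧ g y = t) (x : P) (φ : Form) :
    forces (fun p => {x | Form.var p ∈ (g x).1}) x φ ↔ φ ∈ (g x).1 := by
  induction φ generalizing x with
  | var p => rfl
  | bot => simpa [forces] using (g x).2.bot_notMem
  | and φ ψ ihφ ihψ =>
    simp only [forces, ihφ, ihψ]
    exact ⟨fun h => (g x).2.and_mem h.1 h.2,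
      fun h => ⟨(g x).2.left_mem h, (g x).2.right_mem h⟩⟩
  | or φ ψ ihφ ihψ =>
    simp only [forces, ihφ, ihψ]
    exact ⟨fun h => h.elim (g x).2.or_mem_left (g x).2.or_mem_right, (g x).2.prime⟩
  | imp φ ψ ihφ ihψ =>
    simp only [forces, ihφ, ihψ, Canon.imp_mem_iff]
    refine ⟨fun h t hxt => ?_, fun h y hxy => h (g y) (hmono hxy)⟩
    obtain ⟨y, hxy, rfl⟩ := hback x t hxt
    exact h y hxy

theorem IsPrimeTheory.eq_of_lam_mem {n : ℕ} {T : Set Form} (hT : IsPrimeTheory n T)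
    {p : Fin n → ℕ} {i j : Fin n} (hi : lam n p i ∈ T) (hj : lam n p j ∈ T) : i = j := by
  by_contra hne
  have := (hT.foldr_and_mem_iff _ fun k => (Form.var (p k)).neg).1 (hT.right_mem hi) j
    (by simpa using Ne.symm hne)
  exact hT.bot_notMem (hT.mp this (hT.left_mem hj))

/-- Conditional completeness: if n distinct variables are fresh
for `Γ ∪ {α}` and `Γ ⊬_n α`, then `Γ ⊭_n α`. -/
theorem stmt10 (n : ℕ) (hn : 1 ≤ n) (Γ : Set Form) (α : Form)
    (hfresh : ∃ p : Fin n → ℕ, Function.Injective p ∧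
      ∀ i, (∀ γ ∈ Γ, p i ∉ γ.vars) ∧ p i ∉ α.vars)
    (h : ¬ Proves n Γ α) :
    ∃ V : ℕ → Set (Med n), IsVal V ∧
      (∀ γ ∈ Γ, forces V (root n hn) γ) ∧ ¬ forces V (root n hn) α := by
  obtain ⟨p, hp, hfresh⟩ := hfresh
  have hβ : ¬ Proves n Γ (α.or (bigDisj n fun i => (lam n p i).neg)) := by
    rintro ⟨l, hl, hprov⟩
    exact h ⟨l, hl, .ed p hp (fun i => ⟨notMem_vars_foldr_and fun γ hγ =>
      (hfresh i).1 γ (hl γ hγ), (hfresh i).2⟩) hprov⟩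
  obtain ⟨S, hS, hΓS, hβS⟩ := (isTheory_proves n Γ).exists_prime_notMem hβ
  let w : Canon n := ⟨S, hS⟩
  have hend : ∀ i, ∃ e ∈ endSet w, lam n p i ∈ e.1 := by
    intro i
    have hi : (lam n p i).neg ∉ w.1 := fun hi =>
      hβS (hS.or_mem_right (hS.foldr_or_mem (F := fun i => (lam n p i).neg)
        (List.mem_finRange i) hi))
    rw [Form.neg, Canon.imp_mem_iff] at hi
    push Not at hi
    obtain ⟨t, hwt, ht, -⟩ := hi
    obtain ⟨e, he⟩ := endSet_nonempty_of_not_hasChain t.not_hasChain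
    exact ⟨e, endSet_anti hwt he, he.2 ht⟩
  choose e hew hlam using hend
  have he : Function.Injective e := fun i j hij =>
    (e i).2.eq_of_lam_mem (hlam i) (hij ▸ hlam j)
  have hKP : KPFrame (Canon n) := fun _ _ _ => Canon.exists_endSet_subset_union
  obtain ⟨g, hroot, hmono, hback⟩ := hKP.exists_boundedMorphism hn Canon.not_hasChain he hew
  have htruth := forces_iff_mem_of_boundedMorphism hmono hback (root n hn)
  rw [hroot] at htruth
  exact ⟨fun p => {x | Form.var p ∈ (g x).1}, fun q x y hxy hx => hmono hxy hx,
    fun γ hγ => (htruth γ).2 (hΓS (proves_of_mem hγ)),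
    fun hα => hβS (hS.or_mem_left ((htruth α).1 hα))⟩
end

section
/- A formula φ belongs to ML_n for every n ≥ 1 if and only if φ is valid on every Medvedev frame, i.e., for every n ≥ 1, every point w of F_n, and every intuitionistic valuation V on F_n, (F_n,V), w ⊨ φ. -/
/-! ### Kripke semantics and soundness -/

section Semantics

variable {P : Type} [PartialOrder P]

theorem forces_mono {V : ℕ → Set P} (hV : IsVal V) (φ : Form) {x y : P} (hxy : x ≤ y)
    (h : forces V x φ) : forces V y φ := by
  induction φ with
  | var p => exact hV p x y hxy h
  | bot => exact h
  | and a b iha ihb => exact ⟨iha h.1, ihb h.2⟩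
  | or a b iha ihb => exact h.imp iha ihb
  | imp a b => exact fun v hv => h v (hxy.trans hv)

theorem forces_congr {V V' : ℕ → Set P} (φ : Form) (h : ∀ p ∈ φ.vars, V p = V' p) (x : P) :
    forces V x φ ↔ forces V' x φ := by
  induction φ generalizing x with
  | var p => exact Set.ext_iff.1 (h p rfl) x
  | bot => exact Iff.rfl
  | and a b iha ihb =>
    exact and_congr (iha (fun p hp => h p (Or.inl hp)) x) (ihb (fun p hp => h p (Or.inr hp)) x)
  | or a b iha ihb =>
    exact or_congr (iha (fun p hp => h p (Or.inl hp)) x) (ihb (fun p hp => h p (Or.inr hp)) x)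
  | imp a b iha ihb =>
    exact forall_congr' fun v => imp_congr Iff.rfl
      (imp_congr (iha (fun p hp => h p (Or.inl hp)) v) (ihb (fun p hp => h p (Or.inr hp)) v))

theorem forces_subst {V : ℕ → Set P} (σ : ℕ → Form) (φ : Form) (x : P) :
    forces V x (φ.subst σ) ↔ forces (fun p => {y | forces V y (σ p)}) x φ := by
  induction φ generalizing x with
  | var p => exact Iff.rfl
  | bot => exact Iff.rfl
  | and a b iha ihb => exact and_congr (iha x) (ihb x)
  | or a b iha ihb => exact or_congr (iha x) (ihb x)
  | imp a b iha ihb =>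
    exact forall_congr' fun v => imp_congr Iff.rfl (imp_congr (iha v) (ihb v))

/-- Forcing is preserved and reflected by p-morphisms. -/
theorem forces_comap {Q : Type} [PartialOrder Q] (f : Q → P) (hf : Monotone f)
    (hback : ∀ x y, f x ≤ y → ∃ z, x ≤ z ∧ f z = y) (V : ℕ → Set P) (φ : Form) (x : Q) :
    forces (fun p => f ⁻¹' V p) x φ ↔ forces V (f x) φ := by
  induction φ generalizing x with
  | var p => exact Iff.rfl
  | bot => exact Iff.rfl
  | and a b iha ihb => exact and_congr (iha x) (ihb x)
  | or a b iha ihb => exact or_congr (iha x) (ihb x)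
  | imp a b iha ihb =>
    constructor
    · intro h v hv ha
      obtain ⟨z, hz, rfl⟩ := hback x v hv
      exact (ihb z).1 (h z hz ((iha z).2 ha))
    · intro h v hv ha
      exact (ihb v).2 (h (f v) (hf hv) ((iha v).1 ha))

theorem IPC.forces {φ : Form} (h : IPC φ) {V : ℕ → Set P} (hV : IsVal V) (x : P) :
    forces V x φ := by
  induction h generalizing x with
  | ax1 a b => exact fun u _ ha v hv _ => forces_mono hV a hv ha
  | ax2 a b c =>
    exact fun u _ h1 v hv h2 w hw ha => h1 w (hv.trans hw) ha w le_rfl (h2 w hw ha)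
  | andI a b => exact fun u _ ha v hv hb => ⟨forces_mono hV a hv ha, hb⟩
  | andE1 a b => exact fun u _ h => h.1
  | andE2 a b => exact fun u _ h => h.2
  | orI1 a b => exact fun u _ h => Or.inl h
  | orI2 a b => exact fun u _ h => Or.inr h
  | orE a b c => exact fun u _ h1 v hv h2 w hw h => h.elim (h1 w (hv.trans hw)) (h2 w hw)
  | botE a => exact fun u _ h => h.elim
  | mp _ _ ih1 ih2 => exact ih1 x x le_rfl (ih2 x)

theorem forces_foldr_and {ι : Type} {V : ℕ → Set P} (F : ι → Form) (l : List ι) (x : P)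
    (h : ∀ i ∈ l, forces V x (F i)) :
    forces V x (l.foldr (fun i acc => (F i).and acc) Form.top) := by
  induction l with
  | nil => exact fun _ _ h => h
  | cons a l ih =>
    exact ⟨h a List.mem_cons_self, ih fun i hi => h i (List.mem_cons_of_mem _ hi)⟩

theorem exists_forces_of_foldr_or {ι : Type} {V : ℕ → Set P} (F : ι → Form) (l : List ι) (x : P)
    (h : forces V x (l.foldr (fun i acc => (F i).or acc) Form.bot)) :
    ∃ i, forces V x (F i) := by
  induction l with
  | nil => exact h.elim
  | cons a l ih => exact h.elim (fun h => ⟨a, h⟩) ih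

end Semantics

section Medvedev

variable {n : ℕ}

theorem Med.le_iff {X Y : Med n} : X ≤ Y ↔ Y.1 ⊆ X.1 := Iff.rfl

/-- The union of two points, as a point of the Medvedev frame. -/
def Med.union (X Y : Med n) : Med n := ⟨X.1 ∪ Y.1, X.2.mono Finset.subset_union_left⟩

/-- The end point `{i}` of the Medvedev frame. -/
def Med.single (i : Fin n) : Med n := ⟨{i}, Finset.singleton_nonempty i⟩

theorem Med.le_single_iff {X : Med n} {i : Fin n} : X ≤ Med.single i ↔ i ∈ X.1 :=
  Finset.singleton_subset_iff

theorem Med.forces_kpForm {V : ℕ → Set (Med n)} (hV : IsVal V) (X : Med n) :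
    forces V X kpForm := by
  intro Y _ hY
  by_contra hcon
  simp only [forces, not_or, not_forall] at hcon
  obtain ⟨⟨A, hA, hpA, hqA⟩, ⟨B, hB, hpB, hrB⟩⟩ := hcon
  have hAU : A.union B ≤ A :=
    Med.le_iff.2 Finset.subset_union_left
  have hBU : A.union B ≤ B :=
    Med.le_iff.2 Finset.subset_union_right
  have hYU : Y ≤ A.union B :=
    Finset.union_subset hA hB
  have hp : forces V (A.union B) (Form.var 0).neg := by
    intro C hC hpC
    obtain ⟨c, hc⟩ := C.2
    have hpc := hV 0 _ _ (Med.le_single_iff.2 hc) hpC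
    rcases Finset.mem_union.1 (hC hc) with h | h
    · exact (hpA _ (Med.le_single_iff.2 h) hpc).elim
    · exact (hpB _ (Med.le_single_iff.2 h) hpc).elim
  rcases hY _ hYU hp with h | h
  · exact hqA (hV 1 _ _ hAU h)
  · exact hrB (hV 2 _ _ hBU h)

theorem Med.forces_bd (V : ℕ → Set (Med n)) (k : ℕ) (X : Med n) (hX : X.1.card ≤ k) :
    forces V X (bd k) := by
  induction k generalizing X with
  | zero => exact absurd X.2.card_pos (by omega)
  | succ k ih =>
    by_cases h : X ∈ V (k + 1)
    · exact Or.inl h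
    · refine Or.inr fun Y hXY hY => ih Y ?_
      have hne : Y.1 ≠ X.1 := fun e => h (Subtype.ext e ▸ hY)
      have := Finset.card_lt_card (Finset.ssubset_iff_subset_ne.2 ⟨hXY, hne⟩)
      omega

/-- Taking images under `f` as a map of Medvedev frames. -/
def Med.image (f : Fin n → Fin n) (X : Med n) : Med n := ⟨X.1.image f, X.2.image f⟩

theorem Med.image_mono (f : Fin n → Fin n) : Monotone (Med.image f) :=
  fun _ _ h => Finset.image_subset_image h

theorem Med.image_back (f : Fin n → Fin n) (X Y : Med n) (h : Med.image f X ≤ Y) :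
    ∃ Z, X ≤ Z ∧ Med.image f Z = Y := by
  have himg : (X.1.filter fun i => f i ∈ Y.1).image f = Y.1 := by
    ext y
    simp only [Finset.mem_image, Finset.mem_filter]
    constructor
    · rintro ⟨i, ⟨_, hi⟩, rfl⟩
      exact hi
    · intro hy
      obtain ⟨i, hi, rfl⟩ := Finset.mem_image.1 (h hy)
      exact ⟨i, ⟨hi, hy⟩, rfl⟩
  refine ⟨⟨X.1.filter fun i => f i ∈ Y.1, ?_⟩, Finset.filter_subset _ _, Subtype.ext himg⟩
  rw [← Finset.image_nonempty (f := f), himg]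
  exact Y.2

theorem Med.exists_image_root_eq (hn : 1 ≤ n) (X : Med n) :
    ∃ f : Fin n → Fin n, Med.image f (root n hn) = X := by
  obtain ⟨x, hx⟩ := X.2
  refine ⟨fun i => if i ∈ X.1 then i else x, Subtype.ext ?_⟩
  ext y
  simp only [Med.image, root, Finset.mem_image, Finset.mem_univ, true_and]
  constructor
  · rintro ⟨i, rfl⟩
    split_ifs with h
    exacts [h, hx]
  · exact fun hy => ⟨y, if_pos hy⟩

theorem isVal_image {V : ℕ → Set (Med n)} (hV : IsVal V) (f : Fin n → Fin n) :
    IsVal fun p => Med.image f ⁻¹' V p :=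
  fun p _ _ hxy h => hV p _ _ (Med.image_mono f hxy) h

open Classical in
theorem Med.forces_imp_of_ed (hn : 1 ≤ n) {α β : Form} {p : Fin n → ℕ}
    (hp : Function.Injective p) (hfresh : ∀ i, p i ∉ α.vars ∧ p i ∉ β.vars)
    (h : ∀ (V : ℕ → Set (Med n)), IsVal V → ∀ X,
      forces V X (α.imp (β.or (bigDisj n fun i => (lam n p i).neg))))
    {V : ℕ → Set (Med n)} (hV : IsVal V) (X : Med n) : forces V X (α.imp β) := by
  intro Y _ hα
  obtain ⟨f, rfl⟩ := Med.exists_image_root_eq hn Y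
  let W : ℕ → Set (Med n) := fun q =>
    if q ∈ Set.range p then {Z | ∃ i, p i = q ∧ Z.1 = {i}} else Med.image f ⁻¹' V q
  have hWp : ∀ i Z, Z ∈ W (p i) ↔ Z.1 = {i} := by
    intro i Z
    simp only [W, Set.mem_range_self, if_true, Set.mem_ofPred_eq]
    exact ⟨fun ⟨j, hj, hZ⟩ => hp hj ▸ hZ, fun hZ => ⟨i, rfl, hZ⟩⟩
  have hW : IsVal W := by
    intro q x y hxy hx
    by_cases hq : q ∈ Set.range p
    · obtain ⟨i, rfl⟩ := hq
      rw [hWp] at hx ⊢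
      exact y.2.subset_singleton_iff.1 (hx ▸ Med.le_iff.1 hxy)
    · simp only [W, if_neg hq] at hx ⊢
      exact isVal_image hV f q x y hxy hx
  have hagree : ∀ γ : Form, (∀ i, p i ∉ γ.vars) →
      (forces W (root n hn) γ ↔ forces V (Med.image f (root n hn)) γ) := by
    intro γ hγ
    rw [← forces_comap (Med.image f) (Med.image_mono f) (Med.image_back f) V γ]
    refine forces_congr γ (fun q hq => if_neg ?_) _
    rintro ⟨i, rfl⟩
    exact hγ i hq
  have hroot := h W hW (root n hn) _ le_rfl ((hagree α fun i => (hfresh i).1).2 hα)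
  rcases hroot with hβ | hdisj
  · exact (hagree β fun i => (hfresh i).2).1 hβ
  · obtain ⟨i, hi⟩ := exists_forces_of_foldr_or _ _ _ hdisj
    refine (hi (Med.single i) (Finset.subset_univ _) ⟨?_, ?_⟩).elim
    · exact (hWp i _).2 rfl
    · refine forces_foldr_and (fun j => (Form.var (p j)).neg) _ _ fun j hj Z hZ hpZ => ?_
      have hji : j ≠ i := by simpa using hj
      have hZj : Z.1 = {j} := (hWp j Z).1 hpZ
      have hjZ : j ∈ Z.1 := hZj ▸ Finset.mem_singleton_self j
      exact hji (Finset.mem_singleton.1 (hZ hjZ))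

theorem MLn.forces (hn : 1 ≤ n) {φ : Form} (h : MLn n φ) {V : ℕ → Set (Med n)} (hV : IsVal V)
    (X : Med n) : forces V X φ := by
  induction h generalizing V X with
  | ipc h => exact h.forces hV X
  | kp => exact Med.forces_kpForm hV X
  | bdn => exact Med.forces_bd V n X ((Finset.card_le_univ _).trans (by simp))
  | mp _ _ ih1 ih2 => exact ih1 hV X X le_rfl (ih2 hV X)
  | subst σ _ ih =>
    exact (forces_subst σ _ X).2 (ih (fun p _ _ hxy => forces_mono hV (σ p) hxy) X)
  | ed p hp hfresh _ ih => exact Med.forces_imp_of_ed hn hp hfresh (fun V hV X => ih hV X) hV X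

end Medvedev

/-! ### Derivability and prime theories -/

/-- Derivability from `Γ` using theorems of `ML_n` and modus ponens. -/
inductive Der (n : ℕ) (Γ : Set Form) : Form → Prop
  | ax {φ : Form} : MLn n φ → Der n Γ φ
  | hyp {φ : Form} : φ ∈ Γ → Der n Γ φ
  | mp {φ ψ : Form} : Der n Γ (φ.imp ψ) → Der n Γ φ → Der n Γ ψ

namespace Der

variable {n : ℕ} {Γ Δ : Set Form} {φ ψ χ : Form}

theorem ipc (h : IPC φ) : Der n Γ φ := ax (.ipc h)

theorem trans (h : Der n Γ φ) (hΓ : ∀ γ ∈ Γ, Der n Δ γ) : Der n Δ φ := by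
  induction h with
  | ax h => exact ax h
  | hyp h => exact hΓ _ h
  | mp _ _ ih1 ih2 => exact mp ih1 ih2

theorem mono (hΓ : Γ ⊆ Δ) (h : Der n Γ φ) : Der n Δ φ := h.trans fun _ hγ => hyp (hΓ hγ)

theorem imp_self (φ : Form) : Der n Γ (φ.imp φ) :=
  mp (mp (ipc (.ax2 φ (φ.imp φ) φ)) (ipc (.ax1 _ _))) (ipc (.ax1 _ _))

theorem imp_intro (h : Der n (insert φ Γ) ψ) : Der n Γ (φ.imp ψ) := by
  induction h with
  | ax h => exact mp (ipc (.ax1 _ _)) (ax h)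
  | hyp h =>
    rcases h with rfl | h
    · exact imp_self _
    · exact mp (ipc (.ax1 _ _)) (hyp h)
  | mp _ _ ih1 ih2 => exact mp (mp (ipc (.ax2 _ _ _)) ih1) ih2

theorem or_elim (h : Der n Γ (φ.or ψ)) (h1 : Der n (insert φ Γ) χ)
    (h2 : Der n (insert ψ Γ) χ) : Der n Γ χ :=
  mp (mp (mp (ipc (.orE φ ψ χ)) h1.imp_intro) h2.imp_intro) h

theorem or_inl (h : Der n Γ φ) : Der n Γ (φ.or ψ) := mp (ipc (.orI1 _ _)) h

theorem or_inr (h : Der n Γ ψ) : Der n Γ (φ.or ψ) := mp (ipc (.orI2 _ _)) h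

theorem bot_elim (h : Der n Γ .bot) : Der n Γ φ := mp (ipc (.botE _)) h

theorem mln (h : Der n ∅ φ) : MLn n φ := by
  induction h with
  | ax h => exact h
  | hyp h => exact h.elim
  | mp _ _ ih1 ih2 => exact .mp ih1 ih2

/-- Derivability from the union of a nonempty chain is witnessed in a member of the chain. -/
theorem exists_of_sUnion {c : Set (Set Form)} (hc : IsChain (· ⊆ ·) c) (hne : c.Nonempty)
    (h : Der n (⋃₀ c) φ) : ∃ Γ ∈ c, Der n Γ φ := by
  induction h with
  | ax h => exact ⟨_, hne.choose_spec, ax h⟩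
  | hyp h =>
    obtain ⟨Γ, hΓ, h⟩ := h
    exact ⟨Γ, hΓ, hyp h⟩
  | mp _ _ ih1 ih2 =>
    obtain ⟨A, hA, h1⟩ := ih1
    obtain ⟨B, hB, h2⟩ := ih2
    rcases hc.total hA hB with h | h
    · exact ⟨B, hB, mp (h1.mono h) h2⟩
    · exact ⟨A, hA, mp h1 (h2.mono h)⟩

end Der

/-- Prime theories over `ML_n`: the points of its canonical model. -/
@[ext]
structure PrimeTheory (n : ℕ) where
  /-- The formulas belonging to the theory. -/
  carrier : Set Form
  closed : ∀ {φ}, Der n carrier φ → φ ∈ carrier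
  bot_notMem : Form.bot ∉ carrier
  prime : ∀ {φ ψ : Form}, φ.or ψ ∈ carrier → φ ∈ carrier ∨ ψ ∈ carrier

namespace PrimeTheory

variable {n : ℕ}

instance : PartialOrder (PrimeTheory n) :=
  PartialOrder.lift carrier fun _ _ => PrimeTheory.ext

theorem le_iff {S T : PrimeTheory n} : S ≤ T ↔ S.carrier ⊆ T.carrier := Iff.rfl

/-- A set of formulas deriving no member of a nonempty `∨`-directed set `D` extends to a prime
theory that is maximal among such sets. -/
theorem exists_extension {Γ D : Set Form} (hne : D.Nonempty)
    (hD : ∀ a ∈ D, ∀ b ∈ D, ∃ c ∈ D, MLn n (a.imp c) ∧ MLn n (b.imp c))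
    (hΓ : ∀ d ∈ D, ¬ Der n Γ d) :
    ∃ T : PrimeTheory n, Γ ⊆ T.carrier ∧ (∀ d ∈ D, d ∉ T.carrier) ∧
      ∀ S : Set Form, T.carrier ⊆ S → (∀ d ∈ D, ¬ Der n S d) → S = T.carrier := by
  obtain ⟨M, hΓM, hM⟩ := zorn_subset_nonempty {S | ∀ d ∈ D, ¬ Der n S d}
    (fun c hcS hc hcne => ⟨⋃₀ c, fun d hd h => by
      obtain ⟨S, hS, h⟩ := h.exists_of_sUnion hc hcne
      exact hcS hS d hd h, fun _ => Set.subset_sUnion_of_mem⟩) Γ hΓ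
  have hmax : ∀ S, M ⊆ S → (∀ d ∈ D, ¬ Der n S d) → S = M :=
    fun S hS h => (hM.eq_of_subset h hS).symm
  have hins : ∀ φ, φ ∉ M → ∃ d ∈ D, Der n (insert φ M) d := by
    intro φ hφ
    by_contra! hcon
    exact hφ (hmax _ (Set.subset_insert _ _) hcon ▸ Set.mem_insert φ M)
  have hclosed : ∀ {φ}, Der n M φ → φ ∈ M := by
    intro φ h
    by_contra hφ
    obtain ⟨d, hd, h'⟩ := hins φ hφ
    exact hM.prop d hd (.mp h'.imp_intro h)
  refine ⟨⟨M, hclosed, fun h => ?_, fun {φ ψ} h => ?_⟩, hΓM,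
    fun d hd h => hM.prop d hd (.hyp h), hmax⟩
  · exact hM.prop _ hne.choose_spec (Der.hyp h).bot_elim
  · by_contra! hcon
    obtain ⟨a, ha, hφ⟩ := hins φ hcon.1
    obtain ⟨b, hb, hψ⟩ := hins ψ hcon.2
    obtain ⟨c, hc, hac, hbc⟩ := hD a ha b hb
    exact hM.prop c hc ((Der.hyp h).or_elim (.mp (.ax hac) hφ) (.mp (.ax hbc) hψ))

theorem exists_notMem {Γ : Set Form} {φ : Form} (h : ¬ Der n Γ φ) :
    ∃ T : PrimeTheory n, Γ ⊆ T.carrier ∧ φ ∉ T.carrier := by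
  obtain ⟨T, hT, hφ, -⟩ := exists_extension (n := n) (Γ := Γ) (D := {φ}) ⟨φ, rfl⟩
    (by rintro _ rfl _ rfl; exact ⟨_, rfl, (Der.imp_self _).mln, (Der.imp_self _).mln⟩)
    (by rintro _ rfl; exact h)
  exact ⟨T, hT, hφ φ rfl⟩

theorem exists_isMax {Γ : Set Form} (h : ¬ Der n Γ .bot) :
    ∃ T : PrimeTheory n, Γ ⊆ T.carrier ∧ IsMax T := by
  obtain ⟨T, hT, -, hmax⟩ := exists_extension (n := n) (Γ := Γ) (D := {Form.bot}) ⟨_, rfl⟩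
    (by rintro _ rfl _ rfl; exact ⟨_, rfl, (Der.imp_self _).mln, (Der.imp_self _).mln⟩)
    (by rintro _ rfl; exact h)
  refine ⟨T, hT, fun S hS => (hmax S.carrier hS ?_).subset⟩
  rintro _ rfl h
  exact S.bot_notMem (S.closed h)

variable {S T E : PrimeTheory n} {φ ψ : Form}

theorem mp (h : φ.imp ψ ∈ T.carrier) (hφ : φ ∈ T.carrier) : ψ ∈ T.carrier :=
  T.closed (.mp (.hyp h) (.hyp hφ))

theorem or_mem_iff : φ.or ψ ∈ T.carrier ↔ φ ∈ T.carrier ∨ ψ ∈ T.carrier :=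
  ⟨T.prime, fun h => T.closed (h.elim (fun h => (Der.hyp h).or_inl) fun h => (Der.hyp h).or_inr)⟩

theorem and_mem_iff : φ.and ψ ∈ T.carrier ↔ φ ∈ T.carrier ∧ ψ ∈ T.carrier :=
  ⟨fun h => ⟨T.closed (.mp (.ipc (.andE1 _ _)) (.hyp h)),
    T.closed (.mp (.ipc (.andE2 _ _)) (.hyp h))⟩,
    fun h => T.closed (.mp (.mp (.ipc (.andI _ _)) (.hyp h.1)) (.hyp h.2))⟩

theorem not_der_bot : ¬ Der n T.carrier .bot := fun h => T.bot_notMem (T.closed h)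

theorem not_der_insert_bot (h : φ.neg ∉ T.carrier) : ¬ Der n (insert φ T.carrier) .bot :=
  fun h' => h (T.closed h'.imp_intro)

theorem exists_of_imp_notMem (h : φ.imp ψ ∉ T.carrier) :
    ∃ S : PrimeTheory n, T ≤ S ∧ φ ∈ S.carrier ∧ ψ ∉ S.carrier := by
  obtain ⟨S, hS, hψ⟩ := exists_notMem (n := n) (Γ := insert φ T.carrier) (φ := ψ)
    fun h' => h (T.closed h'.imp_intro)
  exact ⟨S, (Set.subset_insert _ _).trans hS, hS (Set.mem_insert _ _), hψ⟩

theorem neg_mem_of_isMax (hE : IsMax E) (h : φ ∉ E.carrier) : φ.neg ∈ E.carrier := by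
  by_contra hneg
  obtain ⟨S, hS, -⟩ := exists_isMax (not_der_insert_bot hneg)
  exact h (hE ((Set.subset_insert _ _).trans hS : E ≤ S) (hS (Set.mem_insert _ _)))

/-! ### The Kreisel–Putnam and bounded depth properties of the canonical frame -/

theorem mem_endSet {E T : PrimeTheory n} : E ∈ endSet T ↔ IsMax E ∧ T ≤ E := Iff.rfl

theorem endSet_nonempty (T : PrimeTheory n) : (endSet T).Nonempty := by
  obtain ⟨E, hE, hmax⟩ := exists_isMax (not_der_bot (T := T))
  exact ⟨E, hmax, hE⟩

theorem endSet_anti (h : S ≤ T) : endSet T ⊆ endSet S := fun _ hE => ⟨hE.1, h.trans hE.2⟩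

theorem endSet_of_isMax (hE : IsMax E) : endSet E = {E} :=
  Set.ext fun _ => ⟨fun h => (hE.eq_of_le h.2).symm, by rintro rfl; exact ⟨hE, le_rfl⟩⟩

theorem kp_mem (T : PrimeTheory n) {φ ψ χ : Form} (h : φ.neg.imp (ψ.or χ) ∈ T.carrier) :
    φ.neg.imp ψ ∈ T.carrier ∨ φ.neg.imp χ ∈ T.carrier := by
  have hkp : MLn n ((φ.neg.imp (ψ.or χ)).imp ((φ.neg.imp ψ).or (φ.neg.imp χ))) :=
    MLn.subst (fun k => if k = 0 then φ else if k = 1 then ψ else χ) .kp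
  exact T.prime (T.closed (.mp (.ax hkp) (.hyp h)))

/-- Finitely many negations used in a derivation can be merged into a single one. -/
theorem exists_neg_imp {Γ N : Set Form} (hbot : Form.bot ∈ N)
    (hN : ∀ a ∈ N, ∀ b ∈ N, a.or b ∈ N) (h : Der n (Γ ∪ Form.neg '' N) φ) :
    ∃ a ∈ N, Der n Γ (a.neg.imp φ) := by
  induction h with
  | ax h => exact ⟨_, hbot, Der.imp_intro (.ax h)⟩
  | hyp h =>
    rcases h with h | ⟨a, ha, rfl⟩
    · exact ⟨_, hbot, Der.imp_intro (.hyp (Or.inr h))⟩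
    · exact ⟨a, ha, Der.imp_self _⟩
  | mp _ _ ih1 ih2 =>
    obtain ⟨a, ha, h1⟩ := ih1
    obtain ⟨b, hb, h2⟩ := ih2
    refine ⟨a.or b, hN a ha b hb, Der.imp_intro (.mp (.mp (h1.mono (Set.subset_insert _ _)) ?_)
      (.mp (h2.mono (Set.subset_insert _ _)) ?_))⟩
    · exact Der.imp_intro (.mp (.hyp (Or.inr (Or.inl rfl))) (Der.hyp (Or.inl rfl)).or_inl)
    · exact Der.imp_intro (.mp (.hyp (Or.inr (Or.inl rfl))) (Der.hyp (Or.inl rfl)).or_inr)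

theorem exists_le_le (T y₁ y₂ : PrimeTheory n) (h₁ : T ≤ y₁) (h₂ : T ≤ y₂) :
    ∃ z, T ≤ z ∧ z ≤ y₁ ∧ z ≤ y₂ ∧ endSet z = endSet y₁ ∪ endSet y₂ := by
  let N : Set Form := {a | a.neg ∈ y₁.carrier ∧ a.neg ∈ y₂.carrier}
  let D : Set Form := {d | ∃ a b, a ∉ y₁.carrier ∧ b ∉ y₂.carrier ∧ d = a.or b}
  have hneg : ∀ (y : PrimeTheory n) (a b : Form), a.neg ∈ y.carrier → b.neg ∈ y.carrier →
      (a.or b).neg ∈ y.carrier := fun y a b ha hb =>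
    y.closed (.mp (.mp (.ipc (.orE a b .bot)) (.hyp ha)) (.hyp hb))
  obtain ⟨z, hz, hzD, -⟩ := exists_extension (n := n) (Γ := T.carrier ∪ Form.neg '' N) (D := D)
    ⟨_, .bot, .bot, y₁.bot_notMem, y₂.bot_notMem, rfl⟩
    (by
      rintro _ ⟨a, b, ha, hb, rfl⟩ _ ⟨a', b', ha', hb', rfl⟩
      refine ⟨(a.or a').or (b.or b'), ⟨_, _, ?_, ?_, rfl⟩, Der.mln (Der.imp_intro ?_),
        Der.mln (Der.imp_intro ?_)⟩
      · simp [or_mem_iff, ha, ha']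
      · simp [or_mem_iff, hb, hb']
      · exact (Der.hyp (Or.inl rfl)).or_elim (Der.hyp (Or.inl rfl)).or_inl.or_inl
          (Der.hyp (Or.inl rfl)).or_inl.or_inr
      · exact (Der.hyp (Or.inl rfl)).or_elim (Der.hyp (Or.inl rfl)).or_inr.or_inl
          (Der.hyp (Or.inl rfl)).or_inr.or_inr)
    (by
      rintro _ ⟨a, b, ha, hb, rfl⟩ h
      obtain ⟨c, hc, h⟩ := exists_neg_imp (N := N)
        ⟨y₁.closed (Der.imp_self _), y₂.closed (Der.imp_self _)⟩
        (fun a ha b hb => ⟨hneg _ _ _ ha.1 hb.1, hneg _ _ _ ha.2 hb.2⟩) h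
      rcases T.kp_mem (T.closed h) with h | h
      · exact ha (mp (h₁ h) hc.1)
      · exact hb (mp (h₂ h) hc.2))
  have hz₁ : z ≤ y₁ := fun a ha => by
    by_contra hcon
    exact hzD _ ⟨a, .bot, hcon, y₂.bot_notMem, rfl⟩ (or_mem_iff.2 (Or.inl ha))
  have hz₂ : z ≤ y₂ := fun a ha => by
    by_contra hcon
    exact hzD _ ⟨.bot, a, y₁.bot_notMem, hcon, rfl⟩ (or_mem_iff.2 (Or.inr ha))
  refine ⟨z, Set.subset_union_left.trans hz, hz₁, hz₂, Set.Subset.antisymm ?_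
    (Set.union_subset (endSet_anti hz₁) (endSet_anti hz₂))⟩
  rintro E ⟨hE, hzE⟩
  by_contra hcon
  simp only [Set.mem_union, mem_endSet, hE, true_and, not_or, le_iff, Set.not_subset] at hcon
  obtain ⟨⟨a, ha, haE⟩, ⟨b, hb, hbE⟩⟩ := hcon
  have hmem : ∀ (y : PrimeTheory n) (c : Form), c ∈ y.carrier → c.neg.neg ∈ y.carrier :=
    fun y c hc => y.closed (Der.imp_intro (.mp (.hyp (Or.inl rfl)) (.hyp (Or.inr hc))))
  have hN : (a.or b).neg ∈ N :=
    ⟨hmem y₁ _ (or_mem_iff.2 (Or.inl ha)), hmem y₂ _ (or_mem_iff.2 (Or.inr hb))⟩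
  exact E.bot_notMem (mp (hzE (hz (Or.inr ⟨_, hN, rfl⟩)))
    (hneg E a b (neg_mem_of_isMax hE haE) (neg_mem_of_isMax hE hbE)))

/-- There is a strictly increasing chain of `k + 1` prime theories starting at `T`. -/
def HasChain : ℕ → PrimeTheory n → Prop
  | 0, _ => True
  | k + 1, T => ∃ S, T < S ∧ HasChain k S

theorem HasChain.anti {k : ℕ} (h : HasChain k T) (hST : S ≤ T) : HasChain k S := by
  cases k with
  | zero => trivial
  | succ k =>
    obtain ⟨U, hU, h⟩ := h
    exact ⟨U, hST.trans_lt hU, h⟩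

theorem bd_subst_congr {σ τ : ℕ → Form} (k : ℕ) (h : ∀ i ≤ k, σ i = τ i) :
    (bd k).subst σ = (bd k).subst τ := by
  induction k with
  | zero => rfl
  | succ k ih => simp [bd, Form.subst, h (k + 1) le_rfl, ih fun i hi => h i (by omega)]

theorem HasChain.exists_bd_notMem {k : ℕ} (h : HasChain k T) :
    ∃ σ, (bd k).subst σ ∉ T.carrier := by
  induction k generalizing T with
  | zero => exact ⟨Form.var, T.bot_notMem⟩
  | succ k ih =>
    obtain ⟨S, hTS, hS⟩ := h
    obtain ⟨σ, hσ⟩ := ih hS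
    obtain ⟨a, haS, haT⟩ := Set.not_subset.1 hTS.not_ge
    refine ⟨Function.update σ (k + 1) a, fun hmem => ?_⟩
    have hbd : (bd k).subst (Function.update σ (k + 1) a) = (bd k).subst σ :=
      bd_subst_congr k fun i hi => Function.update_of_ne (by omega) _ _
    simp only [bd, Form.subst, Function.update_self, hbd] at hmem
    rcases T.prime hmem with h | h
    · exact haT h
    · exact hσ (mp (hTS.le h) haS)

theorem not_hasChain (T : PrimeTheory n) : ¬ HasChain n T := fun h => by
  obtain ⟨σ, hσ⟩ := h.exists_bd_notMem
  exact hσ (T.closed (.ax (.subst σ .bdn)))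

/-- Below `y`, end points of `T` can be added one at a time, lengthening chains. -/
theorem exists_endSet_eq_union {y : PrimeTheory n} (hTy : T ≤ y) {k : ℕ} (hk : HasChain k y)
    (A : Finset (PrimeTheory n)) (hA : ↑A ⊆ endSet T) (hdisj : Disjoint (endSet y) ↑A) :
    ∃ z, T ≤ z ∧ z ≤ y ∧ endSet z = endSet y ∪ ↑A ∧ HasChain (k + A.card) z := by
  classical
  induction A using Finset.induction_on with
  | empty => exact ⟨y, hTy, le_rfl, by simp, hk⟩
  | insert e A he ih =>
    rw [Finset.coe_insert] at hA hdisj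
    obtain ⟨z, hTz, hzy, hz, hc⟩ :=
      ih ((Set.subset_insert _ _).trans hA) (hdisj.mono_right (Set.subset_insert _ _))
    have heT := hA (Set.mem_insert _ _)
    obtain ⟨u, hTu, huz, hue, hu⟩ := exists_le_le T z e hTz heT.2
    rw [endSet_of_isMax heT.1] at hu
    refine ⟨u, hTu, huz.trans hzy, ?_, ?_⟩
    · rw [hu, hz, Finset.coe_insert, Set.union_assoc, Set.union_singleton]
    · rw [Finset.card_insert_of_notMem he, ← add_assoc]
      refine ⟨z, lt_of_le_of_ne huz ?_, hc⟩
      rintro rfl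
      have hmem : e ∈ endSet u := ⟨heT.1, hue⟩
      rw [hz] at hmem
      exact hmem.elim (fun h => hdisj.notMem_of_mem_left h (Set.mem_insert _ _)) he

theorem exists_endSet_eq (A : Finset (PrimeTheory n)) (hne : A.Nonempty) (hA : ↑A ⊆ endSet T) :
    ∃ z, T ≤ z ∧ endSet z = ↑A ∧ HasChain (A.card - 1) z := by
  classical
  obtain ⟨e, he⟩ := hne
  have heT := hA he
  obtain ⟨z, hTz, -, hz, hc⟩ := exists_endSet_eq_union (k := 0) heT.2 trivial (A.erase e)
    ((Finset.coe_subset.2 (Finset.erase_subset _ _)).trans hA)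
    (by simp [endSet_of_isMax heT.1])
  refine ⟨z, hTz, ?_, by simpa [Finset.card_erase_of_mem he] using hc⟩
  rw [hz, endSet_of_isMax heT.1, Set.singleton_union, ← Finset.coe_insert, Finset.insert_erase he]

section Cone

variable {G : PrimeTheory n} {Δ : Fin n → PrimeTheory n}

theorem endSet_eq_range (hn : 1 ≤ n) (hinj : Function.Injective Δ) (hΔ : ∀ i, Δ i ∈ endSet G) :
    endSet G = Set.range Δ := by
  classical
  obtain ⟨z, hGz, hz, hc⟩ := exists_endSet_eq (T := G) (Finset.univ.image Δ)
    ⟨Δ ⟨0, hn⟩, by simp⟩ (by simpa [Set.range_subset_iff] using hΔ)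
  rw [Finset.card_image_of_injective _ hinj, Finset.card_fin] at hc
  rcases hGz.eq_or_lt with rfl | hlt
  · simpa using hz
  · refine absurd (?_ : HasChain n G) (not_hasChain G)
    obtain ⟨m, rfl⟩ : ∃ m, n = m + 1 := ⟨n - 1, by omega⟩
    exact ⟨z, hlt, hc⟩

theorem eq_of_endSet_subset (hinj : Function.Injective Δ) (hG : endSet G = Set.range Δ)
    {z : PrimeTheory n} (hGz : G ≤ z) (hzT : z ≤ T) (h : endSet z ⊆ endSet T) : z = T := by
  classical
  by_contra hne
  have hsub : endSet T ⊆ Set.range Δ := hG ▸ endSet_anti (hGz.trans hzT)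
  have hfin : (endSet T).Finite := (Set.finite_range Δ).subset hsub
  have hEq : endSet z = endSet T := h.antisymm (endSet_anti hzT)
  have hTne : hfin.toFinset.Nonempty := hfin.toFinset_nonempty.2 T.endSet_nonempty
  obtain ⟨u, hTu, -, hc⟩ := exists_endSet_eq (T := T) hfin.toFinset hTne (by simp)
  have hcz : HasChain hfin.toFinset.card z := by
    have hpos := hTne.card_pos
    obtain ⟨m, hm⟩ : ∃ m, hfin.toFinset.card = m + 1 := ⟨hfin.toFinset.card - 1, by omega⟩
    rw [hm] at hc ⊢
    exact ⟨T, lt_of_le_of_ne hzT hne, hc.anti hTu⟩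
  obtain ⟨w, -, -, -, hw⟩ := exists_endSet_eq_union hGz hcz (Finset.univ.image Δ \ hfin.toFinset)
    (by rw [hG]; intro x; simp +contextual)
    (by rw [hEq, Set.disjoint_left]; simp +contextual)
  rw [Finset.card_sdiff_of_subset (by
      intro x hx
      simpa using hsub (hfin.mem_toFinset.1 hx)), Finset.card_image_of_injective _ hinj,
    Finset.card_fin] at hw
  have hle : hfin.toFinset.card ≤ n := by
    calc hfin.toFinset.card ≤ (Finset.univ.image Δ).card :=
          Finset.card_le_card fun x hx => by simpa using hsub (hfin.mem_toFinset.1 hx)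
      _ = n := by rw [Finset.card_image_of_injective _ hinj, Finset.card_fin]
  rw [Nat.add_sub_cancel' hle] at hw
  exact not_hasChain w hw

theorem le_of_endSet_subset (hinj : Function.Injective Δ) (hG : endSet G = Set.range Δ)
    {S T : PrimeTheory n} (hS : G ≤ S) (hT : G ≤ T) (h : endSet T ⊆ endSet S) : S ≤ T := by
  obtain ⟨z, hGz, hzS, hzT, hz⟩ := exists_le_le G S T hS hT
  rw [Set.union_eq_left.2 h] at hz
  exact eq_of_endSet_subset hinj hG hGz hzS hz.subset ▸ hzT

/-- If a prime theory has `n` distinct end points above it, then every formula outside it is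
refuted at the root of the `n`-Medvedev frame. -/
theorem exists_not_forces (hn : 1 ≤ n) (hinj : Function.Injective Δ)
    (hΔ : ∀ i, Δ i ∈ endSet G) (hφ : φ ∉ G.carrier) :
    ∃ V : ℕ → Set (Med n), IsVal V ∧ ¬ forces V (root n hn) φ := by
  classical
  have hG := endSet_eq_range hn hinj hΔ
  have hex : ∀ X : Med n, ∃ z, G ≤ z ∧ endSet z = Δ '' X.1 := by
    intro X
    obtain ⟨z, hz, h, -⟩ := exists_endSet_eq (T := G) (X.1.image Δ) (X.2.image Δ)
      (by rw [hG, Finset.coe_image]; exact Set.image_subset_range _ _)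
    exact ⟨z, hz, by simpa using h⟩
  choose z hGz hz using hex
  have hmono : ∀ X Y : Med n, X ≤ Y → z X ≤ z Y := fun X Y hXY =>
    le_of_endSet_subset hinj hG (hGz X) (hGz Y)
      (by rw [hz, hz]; exact Set.image_mono (Finset.coe_subset.2 hXY))
  have htruth : ∀ (ψ : Form) (X : Med n),
      forces (fun p => {Y | Form.var p ∈ (z Y).carrier}) X ψ ↔ ψ ∈ (z X).carrier := by
    intro ψ
    induction ψ with
    | var p => exact fun X => Iff.rfl
    | bot => exact fun X => ⟨fun h => h.elim, fun h => (z X).bot_notMem h⟩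
    | and a b iha ihb => exact fun X => (and_congr (iha X) (ihb X)).trans and_mem_iff.symm
    | or a b iha ihb => exact fun X => (or_congr (iha X) (ihb X)).trans or_mem_iff.symm
    | imp a b iha ihb =>
      intro X
      constructor
      · intro h
        by_contra hcon
        obtain ⟨S, hXS, ha, hb⟩ := exists_of_imp_notMem hcon
        have hGS := (hGz X).trans hXS
        have hSX : endSet S ⊆ Δ '' X.1 := hz X ▸ endSet_anti hXS
        obtain ⟨e, he⟩ := S.endSet_nonempty
        obtain ⟨i, hi, rfl⟩ := hSX he
        let Y : Med n := ⟨X.1.filter fun i => Δ i ∈ endSet S, i, Finset.mem_filter.2 ⟨hi, he⟩⟩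
        have hY : endSet (z Y) = endSet S := by
          rw [hz]
          ext e
          constructor
          · rintro ⟨i, hi, rfl⟩
            exact (Finset.mem_filter.1 hi).2
          · intro he
            obtain ⟨i, hi, rfl⟩ := hSX he
            exact ⟨i, Finset.mem_filter.2 ⟨hi, he⟩, rfl⟩
        have hYS : z Y = S := le_antisymm
          (le_of_endSet_subset hinj hG (hGz Y) hGS hY.symm.subset)
          (le_of_endSet_subset hinj hG hGS (hGz Y) hY.subset)
        exact hb (hYS ▸ (ihb Y).1 (h Y (Finset.filter_subset _ _) ((iha Y).2 (hYS ▸ ha))))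
      · exact fun h Y hXY ha => (ihb Y).2 (mp (hmono X Y hXY h) ((iha Y).1 ha))
  refine ⟨fun p => {Y | Form.var p ∈ (z Y).carrier}, fun p X Y hXY h => hmono X Y hXY h,
    fun h => hφ ?_⟩
  have hroot : z (root n hn) ≤ G := le_of_endSet_subset hinj hG (hGz _) le_rfl
    (by rw [hz, hG]; simp [root])
  exact hroot ((htruth φ _).1 h)

end Cone

end PrimeTheory

/-! ### Completeness -/

theorem Form.exists_vars_lt (φ : Form) : ∃ m, ∀ q ∈ φ.vars, q < m := by
  have key : ∀ a b : Form, (∃ m, ∀ q ∈ a.vars, q < m) → (∃ m, ∀ q ∈ b.vars, q < m) →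
      ∃ m, ∀ q ∈ a.vars ∪ b.vars, q < m := fun a b ⟨m, hm⟩ ⟨k, hk⟩ =>
    ⟨max m k, fun q hq => lt_max_iff.2 (hq.imp (hm q) (hk q))⟩
  induction φ with
  | var p => exact ⟨p + 1, fun q hq => by rw [Set.mem_singleton_iff.1 hq]; omega⟩
  | bot => exact ⟨0, fun q hq => hq.elim⟩
  | and a b iha ihb => exact key a b iha ihb
  | or a b iha ihb => exact key a b iha ihb
  | imp a b iha ihb => exact key a b iha ihb

theorem PrimeTheory.mem_of_foldr_and_mem {n : ℕ} {T : PrimeTheory n} {ι : Type} (F : ι → Form)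
    (l : List ι) (h : l.foldr (fun i acc => (F i).and acc) Form.top ∈ T.carrier) {i : ι}
    (hi : i ∈ l) : F i ∈ T.carrier := by
  induction l with
  | nil => simp at hi
  | cons a l ih =>
    obtain ⟨h1, h2⟩ := and_mem_iff.1 h
    rcases List.mem_cons.1 hi with rfl | hi
    exacts [h1, ih h2 hi]

theorem PrimeTheory.foldr_or_mem {n : ℕ} {T : PrimeTheory n} {ι : Type} (F : ι → Form)
    (l : List ι) {i : ι} (hi : i ∈ l) (h : F i ∈ T.carrier) :
    l.foldr (fun i acc => (F i).or acc) Form.bot ∈ T.carrier := by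
  induction l with
  | nil => simp at hi
  | cons a l ih =>
    rcases List.mem_cons.1 hi with rfl | hi
    · exact or_mem_iff.2 (Or.inl h)
    · exact or_mem_iff.2 (Or.inr (ih hi))

theorem MLn.of_forces_root {n : ℕ} (hn : 1 ≤ n) {φ : Form}
    (h : ∀ V : ℕ → Set (Med n), IsVal V → _root_.forces V (root n hn) φ) : MLn n φ := by
  by_contra hφ
  obtain ⟨m, hm⟩ := φ.exists_vars_lt
  let p : Fin n → ℕ := fun i => m + i
  have hp : Function.Injective p := fun i j hij => Fin.ext (Nat.add_left_cancel hij)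
  have hnot : ¬ Der n ∅ (φ.or (bigDisj n fun i => (lam n p i).neg)) := by
    intro hder
    have htop : MLn n (Form.top.imp φ) := by
      refine .ed p hp (fun i => ⟨by simp [Form.top, Form.vars], fun hi => ?_⟩)
        (Der.mln (Der.imp_intro (hder.mono (Set.empty_subset _))))
      have := hm _ hi
      simp only [p] at this
      omega
    exact hφ (.mp htop (Der.imp_self _).mln)
  obtain ⟨G, -, hG⟩ := PrimeTheory.exists_notMem hnot
  rw [PrimeTheory.or_mem_iff, not_or] at hG
  have hex : ∀ i, ∃ E : PrimeTheory n, E ∈ endSet G ∧ lam n p i ∈ E.carrier := by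
    intro i
    have hi : (lam n p i).neg ∉ G.carrier := fun hi =>
      hG.2 (PrimeTheory.foldr_or_mem (fun i => (lam n p i).neg) _ (List.mem_finRange i) hi)
    obtain ⟨E, hE, hmax⟩ := PrimeTheory.exists_isMax (PrimeTheory.not_der_insert_bot hi)
    exact ⟨E, ⟨hmax, (Set.subset_insert _ _).trans hE⟩, hE (Set.mem_insert _ _)⟩
  choose Δ hΔ hlam using hex
  have hinj : Function.Injective Δ := by
    intro i j hij
    by_contra hne
    have hi := (PrimeTheory.and_mem_iff.1 (hlam i)).1
    have hneg : (Form.var (p i)).neg ∈ (Δ j).carrier :=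
      PrimeTheory.mem_of_foldr_and_mem (fun k => (Form.var (p k)).neg) _
        (PrimeTheory.and_mem_iff.1 (hlam j)).2 (by simpa using hne)
    exact (Δ j).bot_notMem (PrimeTheory.mp hneg (hij ▸ hi))
  obtain ⟨V, hV, hnf⟩ := PrimeTheory.exists_not_forces hn hinj hΔ hG.1
  exact hnf (h V hV)

/-- `φ ∈ ML_n` for every `n ≥ 1` iff `φ` is valid on every
Medvedev frame. -/
theorem stmt13 (φ : Form) :
    (∀ n : ℕ, 1 ≤ n → MLn n φ) ↔
    (∀ n : ℕ, 1 ≤ n → ∀ w : Med n, ∀ V : ℕ → Set (Med n), IsVal V →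
      forces V w φ) := by
  exact ⟨fun h n hn w V hV => (h n hn).forces hn hV w,
    fun h n hn => .of_forces_root hn fun V hV => h n hn _ V hV⟩
end
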